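/- arXiv:1809.03459 — 4 statements merged into one kernel-verified Lean document; each statement's English description precedes it below -/
import Mathlib

section
/- The function p_N is twice continuously differentiable on ℝ and satisfies the resolvent ordinary differential equation (N/(2(N−1)))·p_N''(x) − α·p_N(x) + h(((N−1)/N)·x) = 0 for all x ∈ ℝ. -/
open MeasureTheory Real Set Filter Topology ProbabilityTheory

/-- The discounted expected cost functional defining `p_N`. -/
noncomputable def pN (N : ℕ) (α : ℝ) (h : ℝ → ℝ) : ℝ → ℝ := fun x =>
  ∫ t in Ioi (0:ℝ), Real.exp (-α * t) *
    ∫ u, h (((N:ℝ) - 1) / N * x + u) ∂(gaussianReal 0 (((N:ℝ) - 1) / N * t).toNNReal)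

/-- A function whose derivative grows at most linearly grows at most quadratically. -/
lemma exists_quadratic_bound_of_linear_bound_deriv {f f' : ℝ → ℝ} {C : ℝ}
    (hf : ∀ x, HasDerivAt f (f' x) x) (hf' : ∀ x, |f' x| ≤ C * (1 + |x|)) :
    ∃ D, 0 ≤ D ∧ ∀ x, |f x| ≤ D * (1 + x ^ 2) := by
  have hC : 0 ≤ C := by simpa using (abs_nonneg _).trans (hf' 0)
  refine ⟨|f 0| + 2 * C, by positivity, fun x => ?_⟩
  have h1 := Convex.norm_image_sub_le_of_norm_hasDerivWithin_le (f := f) (f' := f')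
    (s := Set.uIcc 0 x) (x := 0) (y := x) (C := C * (1 + |x|))
    (fun z _ => (hf z).hasDerivWithinAt)
    (fun z hz => by
      have h2 : |z| ≤ |x| := by simpa using abs_sub_left_of_mem_uIcc hz
      rw [Real.norm_eq_abs]
      exact (hf' z).trans (by gcongr))
    (convex_uIcc 0 x) left_mem_uIcc right_mem_uIcc
  rw [sub_zero, Real.norm_eq_abs, Real.norm_eq_abs] at h1
  have h3 : |f x| ≤ |f 0| + |f x - f 0| := by
    simpa using abs_add_le (f 0) (f x - f 0)
  have h4 : (1 + |x|) * |x| ≤ 2 * (1 + x ^ 2) := by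
    nlinarith [sq_abs x, sq_nonneg (|x| - 1)]
  nlinarith [mul_le_mul_of_nonneg_left h4 hC, abs_nonneg (f 0), sq_nonneg x,
    mul_nonneg (abs_nonneg (f 0)) (sq_nonneg x)]

/-- A function with bounded derivative grows at most linearly. -/
lemma exists_linear_bound_of_bounded_deriv {f f' : ℝ → ℝ} {C : ℝ}
    (hf : ∀ x, HasDerivAt f (f' x) x) (hf' : ∀ x, |f' x| ≤ C) :
    ∃ D, 0 ≤ D ∧ ∀ x, |f x| ≤ D * (1 + |x|) := by
  have hC : 0 ≤ C := (abs_nonneg _).trans (hf' 0)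
  refine ⟨|f 0| + C, by positivity, fun x => ?_⟩
  have h1 := Convex.norm_image_sub_le_of_norm_hasDerivWithin_le (f := f) (f' := f')
    (s := Set.univ) (x := 0) (y := x) (C := C)
    (fun z _ => (hf z).hasDerivWithinAt) (fun z _ => hf' z) convex_univ trivial trivial
  rw [sub_zero, Real.norm_eq_abs, Real.norm_eq_abs] at h1
  have h3 : |f x| ≤ |f 0| + |f x - f 0| := by
    simpa using abs_add_le (f 0) (f x - f 0)
  nlinarith [mul_nonneg (abs_nonneg (f 0)) (abs_nonneg x)]

section WeightedShift

variable {X : Type*} [MeasurableSpace X] {μ : Measure X} {ρ w : X → ℝ}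

/-- Weighted translates of a function of quadratic growth are integrable when the shift has a
finite weighted second moment. -/
lemma integrable_weight_mul_comp_add {f : ℝ → ℝ} {C : ℝ} (hf : Continuous f)
    (hfC : ∀ x, |f x| ≤ C * (1 + x ^ 2)) (hρ : Integrable ρ μ) (hw : Measurable w)
    (hρw : Integrable (fun p => ρ p * w p ^ 2) μ) (y : ℝ) :
    Integrable (fun p => ρ p * f (y + w p)) μ := by
  have hC : 0 ≤ C := by simpa using (abs_nonneg _).trans (hfC 0)
  have hb : Integrable (fun p => C * ((1 + 2 * y ^ 2) * |ρ p| + 2 * |ρ p * w p ^ 2|)) μ :=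
    ((hρ.abs.const_mul _).add (hρw.abs.const_mul _)).const_mul _
  refine hb.mono' (hρ.aestronglyMeasurable.mul
    (hf.measurable.comp (measurable_const.add hw)).aestronglyMeasurable) (ae_of_all _ fun p => ?_)
  rw [Real.norm_eq_abs, abs_mul, abs_mul, abs_of_nonneg (sq_nonneg (w p))]
  have h1 : |f (y + w p)| ≤ C * (1 + 2 * y ^ 2 + 2 * w p ^ 2) :=
    (hfC _).trans (mul_le_mul_of_nonneg_left (by nlinarith [sq_nonneg (y - w p)]) hC)
  nlinarith [mul_le_mul_of_nonneg_left h1 (abs_nonneg (ρ p))]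

/-- Differentiation under the integral sign for weighted translates. -/
lemma hasDerivAt_integral_weight_mul_comp_add {f f' : ℝ → ℝ} {C D : ℝ}
    (hf : ∀ x, HasDerivAt f (f' x) x) (hf' : Continuous f')
    (hfC : ∀ x, |f x| ≤ C * (1 + x ^ 2)) (hfD : ∀ x, |f' x| ≤ D * (1 + x ^ 2))
    (hρ : Integrable ρ μ) (hw : Measurable w)
    (hρw : Integrable (fun p => ρ p * w p ^ 2) μ) (y : ℝ) :
    HasDerivAt (fun y => ∫ p, ρ p * f (y + w p) ∂μ) (∫ p, ρ p * f' (y + w p) ∂μ) y := by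
  have hD : 0 ≤ D := by simpa using (abs_nonneg _).trans (hfD 0)
  have hfc : Continuous f := continuous_iff_continuousAt.2 fun x => (hf x).continuousAt
  have hb : Integrable
      (fun p => D * ((1 + 2 * (|y| + 1) ^ 2) * |ρ p| + 2 * |ρ p * w p ^ 2|)) μ :=
    ((hρ.abs.const_mul _).add (hρw.abs.const_mul _)).const_mul _
  refine (hasDerivAt_integral_of_dominated_loc_of_deriv_le
    (F := fun y p => ρ p * f (y + w p)) (F' := fun y p => ρ p * f' (y + w p))
    (Metric.ball_mem_nhds y one_pos)
    (Eventually.of_forall fun z =>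
      (integrable_weight_mul_comp_add hfc hfC hρ hw hρw z).aestronglyMeasurable)
    (integrable_weight_mul_comp_add hfc hfC hρ hw hρw y)
    (integrable_weight_mul_comp_add hf' hfD hρ hw hρw y).aestronglyMeasurable
    (ae_of_all _ fun p z hz => ?_) hb (ae_of_all _ fun p z _ => ?_)).2
  · rw [Real.norm_eq_abs, abs_mul, abs_mul, abs_of_nonneg (sq_nonneg (w p))]
    have hz' : |z| ≤ |y| + 1 := by
      rw [Metric.mem_ball, Real.dist_eq] at hz
      have := abs_add_le y (z - y)
      rw [add_sub_cancel] at this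
      linarith
    have hz2 : z ^ 2 ≤ (|y| + 1) ^ 2 := by
      rw [← sq_abs z]; gcongr
    have h1 : |f' (z + w p)| ≤ D * (1 + 2 * (|y| + 1) ^ 2 + 2 * w p ^ 2) :=
      (hfD _).trans (mul_le_mul_of_nonneg_left (by nlinarith [sq_nonneg (z - w p)]) hD)
    nlinarith [mul_le_mul_of_nonneg_left h1 (abs_nonneg (ρ p))]
  · exact ((hf (z + w p)).comp_add_const z (w p)).const_mul (ρ p)

/-- Weighted averages of translates of a bounded continuous function are continuous. -/
lemma continuous_integral_weight_mul_comp_add {f : ℝ → ℝ} {C : ℝ} (hf : Continuous f)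
    (hfC : ∀ x, |f x| ≤ C) (hρ : Integrable ρ μ) (hw : Measurable w) :
    Continuous fun y => ∫ p, ρ p * f (y + w p) ∂μ := by
  refine continuous_of_dominated (bound := fun p => |ρ p| * C) (fun y =>
    hρ.aestronglyMeasurable.mul
      (hf.measurable.comp (measurable_const.add hw)).aestronglyMeasurable)
    (fun y => ae_of_all _ fun p => ?_) (hρ.abs.mul_const C) (ae_of_all _ fun p => by fun_prop)
  rw [Real.norm_eq_abs, abs_mul]
  gcongr
  exact hfC _

end WeightedShift

lemma integrable_sq_gaussianReal (m : ℝ) (v : NNReal) :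
    Integrable (fun z : ℝ => z ^ 2) (gaussianReal m v) :=
  (memLp_id_gaussianReal (μ := m) (v := v) 2).integrable_sq

lemma integrable_gaussianReal_iff {m : ℝ} {v : NNReal} (hv : v ≠ 0) {f : ℝ → ℝ} :
    Integrable f (gaussianReal m v) ↔ Integrable (fun z => gaussianPDFReal m v z * f z) := by
  rw [gaussianReal_of_var_ne_zero m hv, integrable_withDensity_iff_integrable_smul₀'
    (measurable_gaussianPDF m v).aemeasurable (ae_of_all _ fun _ => gaussianPDF_lt_top)]
  simp [toReal_gaussianPDF]

/-- Gaussian integration by parts (Stein's identity) for the standard normal law. -/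
lemma integral_id_mul_gaussianReal_eq_integral_deriv {f f' : ℝ → ℝ}
    (hf : ∀ x, HasDerivAt f (f' x) x) (hfi : Integrable f (gaussianReal 0 1))
    (hxf : Integrable (fun z => z * f z) (gaussianReal 0 1))
    (hf' : Integrable f' (gaussianReal 0 1)) :
    ∫ z, z * f z ∂gaussianReal 0 1 = ∫ z, f' z ∂gaussianReal 0 1 := by
  have hφ : ∀ x, HasDerivAt (gaussianPDFReal 0 1) (-(x * gaussianPDFReal 0 1 x)) x := by
    intro x
    rw [gaussianPDFReal_def]
    have h1 : HasDerivAt (fun x : ℝ => -(x - 0) ^ 2 / (2 * ((1 : NNReal) : ℝ))) (-x) x := by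
      refine (((((hasDerivAt_id x).sub_const 0).pow 2).neg).div_const
        (2 * ((1 : NNReal) : ℝ))).congr_deriv ?_
      simp
      ring
    refine ((h1.exp).const_mul ((√(2 * Real.pi * ((1 : NNReal) : ℝ)))⁻¹)).congr_deriv ?_
    ring
  rw [integrable_gaussianReal_iff one_ne_zero] at hfi hxf hf'
  have key := integral_mul_deriv_eq_deriv_mul_of_integrable (u := f) (u' := f')
    (v := gaussianPDFReal 0 1) (v' := fun x => -(x * gaussianPDFReal 0 1 x))
    (fun x _ => hf x) (fun x _ => hφ x)
    (by refine hxf.neg.congr (ae_of_all _ fun x => ?_)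
        simp only [Pi.neg_apply, Pi.mul_apply]; ring)
    (by refine hf'.congr (ae_of_all _ fun x => ?_)
        simp only [Pi.mul_apply]; ring)
    (by refine hfi.congr (ae_of_all _ fun x => ?_)
        simp only [Pi.mul_apply]; ring)
  rw [integral_gaussianReal_eq_integral_smul one_ne_zero,
    integral_gaussianReal_eq_integral_smul one_ne_zero]
  simp only [smul_eq_mul]
  calc ∫ z, gaussianPDFReal 0 1 z * (z * f z)
      = -∫ z, f z * -(z * gaussianPDFReal 0 1 z) := by
        rw [← integral_neg]; congr with z; ring
    _ = ∫ z, f' z * gaussianPDFReal 0 1 z := by rw [key, neg_neg]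
    _ = _ := by congr with z; ring

/-- Integrals against a centered Gaussian as integrals against the standard normal law. -/
lemma integral_gaussianReal_zero_toNNReal {f : ℝ → ℝ} (hf : Continuous f) {v : ℝ} (hv : 0 ≤ v) :
    ∫ u, f u ∂gaussianReal 0 v.toNNReal = ∫ z, f (√v * z) ∂gaussianReal 0 1 := by
  have h1 : gaussianReal 0 v.toNNReal = (gaussianReal 0 1).map (fun x => √v * x) := by
    rw [gaussianReal_map_const_mul, mul_zero, mul_one]
    congr 1
    ext
    simp [Real.sq_sqrt hv, hv]
  rw [h1, integral_map (by fun_prop) hf.aestronglyMeasurable]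

/-- The derivative of a Gaussian average in its standard deviation. -/
lemma hasDerivAt_integral_gaussianReal_scale {f f' f'' : ℝ → ℝ} {C : ℝ}
    (hf : ∀ x, HasDerivAt f (f' x) x) (hf' : ∀ x, HasDerivAt f' (f'' x) x)
    (hf''c : Continuous f'') (hf'' : ∀ x, |f'' x| ≤ C) (y s : ℝ) :
    HasDerivAt (fun s => ∫ z, f (y + s * z) ∂gaussianReal 0 1)
      (s * ∫ z, f'' (y + s * z) ∂gaussianReal 0 1) s := by
  obtain ⟨D, hD, hf'D⟩ := exists_linear_bound_of_bounded_deriv hf' hf''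
  obtain ⟨E, hE, hfE⟩ := exists_quadratic_bound_of_linear_bound_deriv hf hf'D
  have hfc : Continuous f := continuous_iff_continuousAt.2 fun x => (hf x).continuousAt
  have hf'c : Continuous f' := continuous_iff_continuousAt.2 fun x => (hf' x).continuousAt
  have hsq := integrable_sq_gaussianReal 0 1
  have hf'Q : ∀ x, |f' x| ≤ (2 * D) * (1 + x ^ 2) := fun x => (hf'D x).trans (by
    nlinarith [mul_nonneg hD (sq_nonneg (|x| - 1)), sq_abs x, mul_nonneg hD (sq_nonneg x)])
  have hint : ∀ {g : ℝ → ℝ} {B : ℝ} (_ : Continuous g) (_ : ∀ x, |g x| ≤ B * (1 + x ^ 2)) (s : ℝ),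
      Integrable (fun z => g (y + s * z)) (gaussianReal 0 1) := fun hg hgB s => by
    simpa using integrable_weight_mul_comp_add (ρ := fun _ => 1) (w := fun z => s * z) hg hgB
      (integrable_const _) (by fun_prop)
      (by simpa [mul_pow] using hsq.const_mul (s ^ 2)) y
  have hbd : ∀ r z, |r| ≤ |s| + 1 →
      |z * f' (y + r * z)| ≤ D * (1 + |y| + |s| + 1) * (2 + 2 * z ^ 2) := fun r z hr => by
    have h1 : |y + r * z| ≤ |y| + (|s| + 1) * |z| := (abs_add_le _ _).trans (by
      rw [abs_mul]; gcongr)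
    have h2 : |f' (y + r * z)| ≤ D * (1 + (|y| + (|s| + 1) * |z|)) :=
      (hf'D _).trans (by gcongr)
    have h3 : |z| ≤ 2 + 2 * z ^ 2 := by nlinarith [sq_abs z, sq_nonneg (|z| - 1)]
    have h4 : |z| * |z| ≤ 2 + 2 * z ^ 2 := by nlinarith [sq_abs z]
    rw [abs_mul]
    calc |z| * |f' (y + r * z)| ≤ |z| * (D * (1 + (|y| + (|s| + 1) * |z|))) := by gcongr
      _ = D * ((1 + |y|) * |z| + (|s| + 1) * (|z| * |z|)) := by ring
      _ ≤ D * ((1 + |y|) * (2 + 2 * z ^ 2) + (|s| + 1) * (2 + 2 * z ^ 2)) := by gcongr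
      _ = _ := by ring
  have hbi : Integrable (fun z : ℝ => D * (1 + |y| + |s| + 1) * (2 + 2 * z ^ 2))
      (gaussianReal 0 1) :=
    ((integrable_const _).add (hsq.const_mul 2)).const_mul _
  obtain ⟨hzi, hder⟩ := hasDerivAt_integral_of_dominated_loc_of_deriv_le
    (μ := gaussianReal 0 1)
    (F := fun s z => f (y + s * z)) (F' := fun s z => z * f' (y + s * z))
    (Metric.ball_mem_nhds s one_pos)
    (Eventually.of_forall fun r => (hint hfc hfE r).aestronglyMeasurable)
    (hint hfc hfE s)
    (by fun_prop)
    (ae_of_all _ fun z r hr => hbd r z (by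
      rw [Metric.mem_ball, Real.dist_eq] at hr
      have := abs_add_le s (r - s)
      rw [add_sub_cancel] at this
      linarith)) hbi
    (ae_of_all _ fun z r _ => by
      have h1 : HasDerivAt (fun r : ℝ => y + r * z) z r := by
        simpa using ((hasDerivAt_id r).mul_const z).const_add y
      exact ((hf (y + r * z)).comp r h1).congr_deriv (mul_comm _ _))
  have hf''i : Integrable (fun z => f'' (y + s * z)) (gaussianReal 0 1) :=
    hint (B := C) hf''c (fun x => (hf'' x).trans (by
      nlinarith [mul_nonneg ((abs_nonneg _).trans (hf'' 0)) (sq_nonneg x)])) s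
  have hst := integral_id_mul_gaussianReal_eq_integral_deriv
    (f := fun z => f' (y + s * z)) (f' := fun z => s * f'' (y + s * z))
    (fun z => by
      have h1 : HasDerivAt (fun z : ℝ => y + s * z) s z := by
        simpa using ((hasDerivAt_id z).const_mul s).const_add y
      exact ((hf' (y + s * z)).comp z h1).congr_deriv (mul_comm _ _))
    (hint hf'c hf'Q s) hzi (hf''i.const_mul s)
  rw [integral_const_mul] at hst
  rwa [← hst]

/-- The law of (time, standard normal), on which the discounted heat semigroup is computed. -/
noncomputable def timeGaussian : Measure (ℝ × ℝ) :=
  (volume.restrict (Ioi (0 : ℝ))).prod (gaussianReal 0 1)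

/-- The resolvent at rate `α` of Brownian motion with variance `c` per unit time. -/
noncomputable def heatResolvent (α c : ℝ) (f : ℝ → ℝ) (y : ℝ) : ℝ :=
  ∫ p, rexp (-α * p.1) * f (y + √(c * p.1) * p.2) ∂timeGaussian

lemma integrable_exp_timeGaussian {α : ℝ} (hα : 0 < α) :
    Integrable (fun p : ℝ × ℝ => rexp (-α * p.1)) timeGaussian := by
  have h1 : IntegrableOn (fun t : ℝ => rexp (-α * t)) (Ioi 0) :=
    integrableOn_exp_mul_Ioi (by linarith) 0
  simpa [timeGaussian] using
    Integrable.mul_prod h1 (integrable_const (μ := gaussianReal 0 1) (1 : ℝ))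

lemma integrable_exp_mul_sq_timeGaussian {α c : ℝ} (hα : 0 < α) (hc : 0 ≤ c) :
    Integrable (fun p : ℝ × ℝ => rexp (-α * p.1) * (√(c * p.1) * p.2) ^ 2) timeGaussian := by
  have h1 : IntegrableOn (fun t : ℝ => c * (t ^ (1 : ℝ) * rexp (-α * t ^ (1 : ℝ)))) (Ioi 0) :=
    (integrableOn_rpow_mul_exp_neg_mul_rpow (by norm_num) one_pos hα).const_mul c
  have h2 : IntegrableOn (fun t : ℝ => rexp (-α * t) * √(c * t) ^ 2) (Ioi 0) :=
    h1.congr_fun (fun t ht => by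
      simp only [Real.rpow_one]
      rw [Real.sq_sqrt (mul_nonneg hc (le_of_lt ht))]; ring) measurableSet_Ioi
  refine (Integrable.mul_prod h2 (integrable_sq_gaussianReal 0 1)).congr
    (ae_of_all _ fun p => ?_)
  simp only
  ring

lemma integrable_exp_mul_comp_timeGaussian {α c C : ℝ} (hα : 0 < α) (hc : 0 ≤ c) {f : ℝ → ℝ}
    (hf : Continuous f) (hfC : ∀ x, |f x| ≤ C * (1 + x ^ 2)) (y : ℝ) :
    Integrable (fun p : ℝ × ℝ => rexp (-α * p.1) * f (y + √(c * p.1) * p.2)) timeGaussian :=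
  integrable_weight_mul_comp_add hf hfC (integrable_exp_timeGaussian hα) (by fun_prop)
    (integrable_exp_mul_sq_timeGaussian hα hc) y

lemma heatResolvent_eq_integral {α c C : ℝ} (hα : 0 < α) (hc : 0 ≤ c) {f : ℝ → ℝ}
    (hf : Continuous f) (hfC : ∀ x, |f x| ≤ C * (1 + x ^ 2)) (y : ℝ) :
    heatResolvent α c f y =
      ∫ t in Ioi (0 : ℝ), rexp (-α * t) * ∫ z, f (y + √(c * t) * z) ∂gaussianReal 0 1 := by
  rw [heatResolvent, timeGaussian,
    integral_prod _ (integrable_exp_mul_comp_timeGaussian hα hc hf hfC y)]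
  simp only [integral_const_mul]

lemma integrableOn_exp_mul_integral_gaussianReal {α c C : ℝ} (hα : 0 < α) (hc : 0 ≤ c)
    {f : ℝ → ℝ} (hf : Continuous f) (hfC : ∀ x, |f x| ≤ C * (1 + x ^ 2)) (y : ℝ) :
    IntegrableOn
      (fun t => rexp (-α * t) * ∫ z, f (y + √(c * t) * z) ∂gaussianReal 0 1) (Ioi 0) := by
  have := (integrable_exp_mul_comp_timeGaussian hα hc hf hfC y).integral_prod_left
  simpa only [integral_const_mul, IntegrableOn] using this

lemma hasDerivAt_heatResolvent {α c C D : ℝ} (hα : 0 < α) (hc : 0 ≤ c) {f f' : ℝ → ℝ}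
    (hf : ∀ x, HasDerivAt f (f' x) x) (hf' : Continuous f')
    (hfC : ∀ x, |f x| ≤ C * (1 + x ^ 2)) (hfD : ∀ x, |f' x| ≤ D * (1 + x ^ 2)) (y : ℝ) :
    HasDerivAt (heatResolvent α c f) (heatResolvent α c f' y) y :=
  hasDerivAt_integral_weight_mul_comp_add hf hf' hfC hfD (integrable_exp_timeGaussian hα)
    (by fun_prop) (integrable_exp_mul_sq_timeGaussian hα hc) y

/-- The resolvent equation `α R f - (c/2) R f'' = f`. -/
lemma heatResolvent_equation {α c C : ℝ} (hα : 0 < α) (hc : 0 < c) {f f' f'' : ℝ → ℝ}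
    (hf : ∀ x, HasDerivAt f (f' x) x) (hf' : ∀ x, HasDerivAt f' (f'' x) x)
    (hf''c : Continuous f'') (hf'' : ∀ x, |f'' x| ≤ C) (y : ℝ) :
    c / 2 * heatResolvent α c f'' y - α * heatResolvent α c f y + f y = 0 := by
  obtain ⟨D, hD, hf'D⟩ := exists_linear_bound_of_bounded_deriv hf' hf''
  obtain ⟨E, hE, hfE⟩ := exists_quadratic_bound_of_linear_bound_deriv hf hf'D
  have hfc : Continuous f := continuous_iff_continuousAt.2 fun x => (hf x).continuousAt
  have hf''Q : ∀ x, |f'' x| ≤ C * (1 + x ^ 2) := fun x => (hf'' x).trans (by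
    nlinarith [mul_nonneg ((abs_nonneg _).trans (hf'' 0)) (sq_nonneg x)])
  have hscale := hasDerivAt_integral_gaussianReal_scale hf hf' hf''c hf'' y
  set g : ℝ → ℝ := fun s => ∫ z, f (y + s * z) ∂gaussianReal 0 1 with hg
  set g₂ : ℝ → ℝ := fun s => ∫ z, f'' (y + s * z) ∂gaussianReal 0 1 with hg₂
  have hgc : Continuous g := continuous_iff_continuousAt.2 fun s => (hscale s).continuousAt
  have hIf : IntegrableOn (fun t => rexp (-α * t) * g √(c * t)) (Ioi 0) :=
    integrableOn_exp_mul_integral_gaussianReal hα hc.le hfc hfE y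
  have hIf'' : IntegrableOn (fun t => rexp (-α * t) * g₂ √(c * t)) (Ioi 0) :=
    integrableOn_exp_mul_integral_gaussianReal hα hc.le hf''c hf''Q y
  have hder : ∀ t ∈ Ioi (0 : ℝ), HasDerivAt (fun t => rexp (-α * t) * g √(c * t))
      (c / 2 * (rexp (-α * t) * g₂ √(c * t)) - α * (rexp (-α * t) * g √(c * t))) t := by
    intro t ht
    have hct : 0 < c * t := mul_pos hc ht
    have h1 : HasDerivAt (fun t : ℝ => √(c * t)) (c / (2 * √(c * t))) t := by
      simpa using ((hasDerivAt_id t).const_mul c).sqrt hct.ne'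
    have h2 : HasDerivAt (fun t : ℝ => rexp (-α * t)) (rexp (-α * t) * -α) t := by
      simpa using ((hasDerivAt_id t).const_mul (-α)).exp
    refine (h2.mul ((hscale √(c * t)).comp t h1)).congr_deriv ?_
    have : √(c * t) ≠ 0 := (Real.sqrt_pos.2 hct).ne'
    change rexp (-α * t) * -α * g √(c * t)
      + rexp (-α * t) * (√(c * t) * g₂ √(c * t) * (c / (2 * √(c * t)))) = _
    generalize √(c * t) = s at this ⊢
    field_simp
    ring
  have hI' := (hIf''.const_mul (c / 2)).sub (hIf.const_mul α)
  have key := integral_Ioi_of_hasDerivAt_of_tendsto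
    (by
      refine Continuous.continuousWithinAt ?_
      fun_prop) hder hI' (tendsto_zero_of_hasDerivAt_of_integrableOn_Ioi hder hI' hIf)
  rw [integral_sub (hIf''.const_mul (c / 2)) (hIf.const_mul α), integral_const_mul,
    integral_const_mul] at key
  have hg0 : g 0 = f y := by simp [hg]
  rw [heatResolvent_eq_integral hα hc.le hfc hfE, heatResolvent_eq_integral hα hc.le hf''c hf''Q]
  simp only [mul_zero, Real.sqrt_zero, hg0, Real.exp_zero, one_mul, zero_sub] at key
  linarith

/-- Under H2', `p_N` is `C²` and solves the resolvent ODE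
`(N/(2(N−1))) p_N''(x) − α p_N(x) + h(((N−1)/N)x) = 0`. -/
theorem pN_solves_resolvent_ODE (N : ℕ) (hN : 2 ≤ N) (α k K : ℝ) (hα : 0 < α)
    (hk : 0 < k) (hkK : k < K) (h : ℝ → ℝ) (hC2 : ContDiff ℝ 2 h)
    (heven : ∀ x, h (-x) = h x) (h0 : 0 ≤ h 0)
    (hmono : AntitoneOn (deriv (deriv h)) (Set.Ici 0))
    (hlb : ∀ x, k ≤ deriv (deriv h) x) (hub : ∀ x, deriv (deriv h) x ≤ K) :
    ContDiff ℝ 2 (pN N α h) ∧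
    ∀ x : ℝ, ((N:ℝ) / (2 * ((N:ℝ) - 1))) * deriv (deriv (pN N α h)) x
        - α * pN N α h x + h (((N:ℝ) - 1) / N * x) = 0 := by
  have hN' : (2 : ℝ) ≤ N := by exact_mod_cast hN
  set c : ℝ := ((N : ℝ) - 1) / N with hc_def
  have hc : 0 < c := div_pos (by linarith) (by linarith)
  have hC1 : ContDiff ℝ 1 (deriv h) := ContDiff.deriv' (n := 1) hC2
  have hh : ∀ x, HasDerivAt h (deriv h x) x := fun x =>
    (hC2.differentiable (by norm_num) x).hasDerivAt
  have hh' : ∀ x, HasDerivAt (deriv h) (deriv (deriv h) x) x := fun x =>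
    (hC1.differentiable (by norm_num) x).hasDerivAt
  have hcont : Continuous (deriv (deriv h)) := hC1.continuous_deriv le_rfl
  have hbd : ∀ x, |deriv (deriv h) x| ≤ K := fun x =>
    abs_le.2 ⟨by linarith [hlb x], hub x⟩
  have hbdQ : ∀ x, |deriv (deriv h) x| ≤ K * (1 + x ^ 2) := fun x => (hbd x).trans (by
    nlinarith [mul_nonneg (hk.trans hkK).le (sq_nonneg x)])
  obtain ⟨D, hD, hh'D⟩ := exists_linear_bound_of_bounded_deriv hh' hbd
  obtain ⟨E, hE, hhE⟩ := exists_quadratic_bound_of_linear_bound_deriv hh hh'D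
  have hh'Q : ∀ x, |deriv h x| ≤ (2 * D) * (1 + x ^ 2) := fun x => (hh'D x).trans (by
    nlinarith [mul_nonneg hD (sq_nonneg (|x| - 1)), sq_abs x, mul_nonneg hD (sq_nonneg x)])
  have hpN : pN N α h = fun x => heatResolvent α c h (c * x) := by
    funext x
    rw [heatResolvent_eq_integral hα hc.le hC2.continuous hhE, pN]
    refine setIntegral_congr_fun measurableSet_Ioi fun t ht => ?_
    rw [integral_gaussianReal_zero_toNNReal (f := fun u => h (c * x + u))
      (hC2.continuous.comp (continuous_const.add continuous_id)) (mul_nonneg hc.le (le_of_lt ht))]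
  have hlin : ∀ x, HasDerivAt (fun x : ℝ => c * x) c x := fun x => by
    simpa using (hasDerivAt_id x).const_mul c
  have hd1 : ∀ x, HasDerivAt (pN N α h) (heatResolvent α c (deriv h) (c * x) * c) x := fun x => by
    rw [hpN]
    exact (hasDerivAt_heatResolvent hα hc.le hh hC1.continuous hhE hh'Q (c * x)).comp x (hlin x)
  have hderiv : deriv (pN N α h) = fun x => heatResolvent α c (deriv h) (c * x) * c :=
    funext fun x => (hd1 x).deriv
  have hd2 : ∀ x, HasDerivAt (deriv (pN N α h))
      (heatResolvent α c (deriv (deriv h)) (c * x) * c * c) x := fun x => by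
    rw [hderiv]
    exact ((hasDerivAt_heatResolvent hα hc.le hh' hcont hh'Q hbdQ (c * x)).comp x
      (hlin x)).mul_const c
  have hderiv2 : deriv (deriv (pN N α h)) =
      fun x => heatResolvent α c (deriv (deriv h)) (c * x) * c * c :=
    funext fun x => (hd2 x).deriv
  have hRc : Continuous (heatResolvent α c (deriv (deriv h))) :=
    continuous_integral_weight_mul_comp_add hcont hbd (integrable_exp_timeGaussian hα)
      (by fun_prop)
  refine ⟨?_, fun x => ?_⟩
  · rw [← one_add_one_eq_two, contDiff_succ_iff_deriv]
    refine ⟨fun x => (hd1 x).differentiableAt, by simp, contDiff_one_iff_deriv.2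
      ⟨fun x => (hd2 x).differentiableAt, ?_⟩⟩
    rw [hderiv2]
    fun_prop
  · have hcoef : (N : ℝ) / (2 * ((N : ℝ) - 1)) * (c * c) = c / 2 := by
      have h1 : (N : ℝ) ≠ 0 := by linarith
      have h2 : (N : ℝ) - 1 ≠ 0 := by linarith
      rw [hc_def]
      field_simp
    have key := heatResolvent_equation hα hc hh hh' hcont hbd (c * x)
    rw [hderiv2, hpN, ← key, ← hcoef]
    ring
end

section
/- The function p_N is twice differentiable and satisfies ((N−1)/N)²·(k/α) ≤ p_N''(x) ≤ ((N−1)/N)²·(K/α) for all x ∈ ℝ; in particular p_N is strictly convex. -/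
open MeasureTheory Real Set Filter Topology ProbabilityTheory

/-- A function of class `C¹` whose derivative grows at most linearly grows at most quadratically. -/
lemma abs_sub_le_of_abs_deriv_le {g : ℝ → ℝ} (hg : Differentiable ℝ g) {A B : ℝ} (hB : 0 ≤ B)
    (hbd : ∀ y, |deriv g y| ≤ A + B * |y|) (y : ℝ) : |g y - g 0| ≤ (A + B * |y|) * |y| := by
  have key := (convex_closedBall (0 : ℝ) |y|).norm_image_sub_le_of_norm_deriv_le
    (f := g) (C := A + B * |y|) (fun z _ => hg z)
    (fun z hz => by
      rw [mem_closedBall_zero_iff, Real.norm_eq_abs] at hz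
      exact (hbd z).trans (by gcongr))
    (x := 0) (y := y) (by simp) (by simp)
  simpa using key

lemma abs_deriv_le_add_mul_abs {h : ℝ → ℝ} (hC2 : ContDiff ℝ 2 h) {K : ℝ}
    (hK : ∀ y, |deriv (deriv h) y| ≤ K) (y : ℝ) :
    |deriv h y| ≤ |deriv h 0| + K * |y| := by
  have hd : Differentiable ℝ (deriv h) :=
    ((contDiff_succ_iff_deriv (n := 1)).1 hC2).2.2.differentiable (by norm_num)
  have key := abs_sub_le_of_abs_deriv_le hd (A := K) (B := 0) le_rfl (by simpa using hK) y
  have := abs_add_le (deriv h y - deriv h 0) (deriv h 0)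
  simp only [sub_add_cancel, zero_mul, add_zero] at key this
  linarith

section QuadraticGrowth

variable {Ω : Type*} [MeasurableSpace Ω] {μ : Measure Ω} [IsFiniteMeasure μ] {X : Ω → ℝ}
  {g : ℝ → ℝ} {A B : ℝ}

lemma abs_add_le_of_quadratic_growth (hB : 0 ≤ B) (hbd : ∀ y, |g y| ≤ A + B * y ^ 2)
    {x r : ℝ} (hx : |x| ≤ r) (z : ℝ) : |g (x + z)| ≤ A + B * (2 * r ^ 2 + 2 * z ^ 2) := by
  refine (hbd _).trans ?_
  have : x ^ 2 ≤ r ^ 2 := sq_le_sq' (by linarith [neg_abs_le x]) ((le_abs_self x).trans hx)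
  gcongr
  nlinarith [sq_nonneg (x - z)]

lemma integrable_comp_add_of_quadratic_growth (hX : AEStronglyMeasurable X μ)
    (hX2 : Integrable (fun ω => X ω ^ 2) μ) (hg : Continuous g) (hB : 0 ≤ B)
    (hbd : ∀ y, |g y| ≤ A + B * y ^ 2) (x : ℝ) : Integrable (fun ω => g (x + X ω)) μ := by
  have hint : Integrable (fun ω => A + B * (2 * |x| ^ 2 + 2 * X ω ^ 2)) μ :=
    (integrable_const _).add (((integrable_const _).add (hX2.const_mul 2)).const_mul B)
  exact hint.mono' (hg.comp_aestronglyMeasurable (hX.const_add x))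
    (Eventually.of_forall fun ω => abs_add_le_of_quadratic_growth hB hbd le_rfl (X ω))

lemma hasDerivAt_integral_comp_add (hX : AEStronglyMeasurable X μ)
    (hX2 : Integrable (fun ω => X ω ^ 2) μ) (hg : Differentiable ℝ g)
    (hg' : Continuous (deriv g)) (hB : 0 ≤ B) (hbd : ∀ y, |deriv g y| ≤ A + B * y ^ 2) (x : ℝ)
    (hint : Integrable (fun ω => g (x + X ω)) μ) :
    HasDerivAt (fun z => ∫ ω, g (z + X ω) ∂μ) (∫ ω, deriv g (x + X ω) ∂μ) x := by
  refine (hasDerivAt_integral_of_dominated_loc_of_deriv_le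
    (F := fun z ω => g (z + X ω)) (F' := fun z ω => deriv g (z + X ω))
    (bound := fun ω => A + B * (2 * (|x| + 1) ^ 2 + 2 * X ω ^ 2))
    (Metric.ball_mem_nhds x one_pos)
    (Eventually.of_forall fun z => hg.continuous.comp_aestronglyMeasurable (hX.const_add z))
    hint (hg'.comp_aestronglyMeasurable (hX.const_add x))
    (Eventually.of_forall fun ω z hz => ?_) ?_ (Eventually.of_forall fun ω z _ => ?_)).2
  · refine abs_add_le_of_quadratic_growth hB hbd ?_ (X ω)
    rw [Metric.mem_ball, Real.dist_eq] at hz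
    have := abs_add_le (z - x) x
    rw [sub_add_cancel] at this
    linarith
  · exact (integrable_const _).add (((integrable_const _).add (hX2.const_mul 2)).const_mul B)
  · exact (hg (z + X ω)).hasDerivAt.comp_add_const z (X ω)

end QuadraticGrowth

/-- The measure with density `exp (-α t)` on the positive half-line. -/
noncomputable def discountMeasure (α : ℝ) : Measure ℝ :=
  (volume.restrict (Ioi (0 : ℝ))).withDensity fun t => ((Real.exp (-α * t)).toNNReal : ENNReal)

section DiscountMeasure

variable {α : ℝ}

lemma integral_discountMeasure (f : ℝ → ℝ) :
    ∫ t, f t ∂discountMeasure α = ∫ t in Ioi (0 : ℝ), Real.exp (-α * t) * f t := by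
  rw [discountMeasure, integral_withDensity_eq_integral_smul (by fun_prop)]
  simp [NNReal.smul_def, Real.exp_nonneg]

lemma integrable_discountMeasure_iff (f : ℝ → ℝ) :
    Integrable f (discountMeasure α) ↔
      IntegrableOn (fun t => Real.exp (-α * t) * f t) (Ioi 0) := by
  rw [discountMeasure, integrable_withDensity_iff_integrable_smul (by fun_prop)]
  simp [NNReal.smul_def, Real.exp_nonneg, IntegrableOn]

lemma ae_pos_discountMeasure : ∀ᵐ t ∂discountMeasure α, 0 < t :=
  (withDensity_absolutelyContinuous _ _).ae_le (ae_restrict_mem measurableSet_Ioi)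

lemma isFiniteMeasure_discountMeasure (hα : 0 < α) : IsFiniteMeasure (discountMeasure α) := by
  exact isFiniteMeasure_withDensity_ofReal
    (integrableOn_exp_mul_Ioi (neg_lt_zero.2 hα) 0).hasFiniteIntegral

lemma measureReal_univ_discountMeasure (hα : 0 < α) : (discountMeasure α).real univ = 1 / α := by
  have h1 := integral_discountMeasure (α := α) fun _ => 1
  have h2 := integral_exp_mul_Ioi (neg_lt_zero.2 hα) 0
  simp only [integral_const, smul_eq_mul, mul_one] at h1
  rw [h1, h2]
  simp

lemma integrable_id_discountMeasure (hα : 0 < α) : Integrable (fun t => t) (discountMeasure α) := by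
  rw [integrable_discountMeasure_iff]
  have := integrableOn_rpow_mul_exp_neg_mul_rpow (p := 1) (s := 1) (by norm_num) one_pos hα
  simpa [mul_comm] using this

end DiscountMeasure

lemma integral_gaussianReal_eq_integral_sqrt_mul (g : ℝ → ℝ) (hg : Continuous g) {v : ℝ}
    (hv : 0 ≤ v) :
    ∫ u, g u ∂gaussianReal 0 v.toNNReal = ∫ z, g (√v * z) ∂gaussianReal 0 1 := by
  have hmap : (gaussianReal 0 1).map (√v * ·) = gaussianReal 0 v.toNNReal := by
    rw [gaussianReal_map_const_mul]
    congr 1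
    · simp
    · ext
      simp [Real.sq_sqrt hv, hv]
  rw [← hmap, integral_map (by fun_prop) hg.aestronglyMeasurable]

lemma integrable_sq_sqrt_mul_prod {α : ℝ} (hα : 0 < α) {c : ℝ} (hc : 0 ≤ c) :
    Integrable (fun ω : ℝ × ℝ => (√(c * ω.1) * ω.2) ^ 2)
      ((discountMeasure α).prod (gaussianReal 0 1)) := by
  have := isFiniteMeasure_discountMeasure hα
  have hsq : Integrable (fun z : ℝ => z ^ 2) (gaussianReal 0 1) :=
    (memLp_id_gaussianReal 2).integrable_sq
  refine (((integrable_id_discountMeasure hα).const_mul c).mul_prod hsq).congr ?_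
  filter_upwards [Measure.quasiMeasurePreserving_fst.ae (ae_pos_discountMeasure (α := α))] with ω hω
  rw [mul_pow, Real.sq_sqrt (mul_nonneg hc hω.le)]

lemma pN_eq_integral_prod {N : ℕ} {α : ℝ} {h : ℝ → ℝ} (hα : 0 < α) (hh : Continuous h)
    (hN : 0 ≤ ((N : ℝ) - 1) / N) (x : ℝ)
    (hint : Integrable
      (fun ω : ℝ × ℝ => h (((N : ℝ) - 1) / N * x + √(((N : ℝ) - 1) / N * ω.1) * ω.2))
      ((discountMeasure α).prod (gaussianReal 0 1))) :
    pN N α h x =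
      ∫ ω : ℝ × ℝ, h (((N : ℝ) - 1) / N * x + √(((N : ℝ) - 1) / N * ω.1) * ω.2)
        ∂(discountMeasure α).prod (gaussianReal 0 1) := by
  have := isFiniteMeasure_discountMeasure hα
  rw [integral_prod _ hint, integral_discountMeasure, pN]
  refine setIntegral_congr_fun measurableSet_Ioi fun t ht => ?_
  simp only
  rw [integral_gaussianReal_eq_integral_sqrt_mul (fun u => h (((N : ℝ) - 1) / N * x + u))
    (by fun_prop) (mul_nonneg hN (le_of_lt ht))]

/-- Under H2', `p_N` is twice differentiable with
`((N−1)/N)²·(k/α) ≤ p_N'' ≤ ((N−1)/N)²·(K/α)`; in particular `p_N` is strictly convex. -/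
theorem pN_second_deriv_bounds (N : ℕ) (hN : 2 ≤ N) (α k K : ℝ) (hα : 0 < α)
    (hk : 0 < k) (hkK : k < K) (h : ℝ → ℝ) (hC2 : ContDiff ℝ 2 h)
    (heven : ∀ x, h (-x) = h x) (h0 : 0 ≤ h 0)
    (hmono : AntitoneOn (deriv (deriv h)) (Set.Ici 0))
    (hlb : ∀ x, k ≤ deriv (deriv h) x) (hub : ∀ x, deriv (deriv h) x ≤ K) :
    Differentiable ℝ (pN N α h) ∧
    Differentiable ℝ (deriv (pN N α h)) ∧
    (∀ x : ℝ, (((N:ℝ) - 1) / N)^2 * (k / α) ≤ deriv (deriv (pN N α h)) x ∧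
        deriv (deriv (pN N α h)) x ≤ (((N:ℝ) - 1) / N)^2 * (K / α)) ∧
    StrictConvexOn ℝ Set.univ (pN N α h) := by
  have hc : 0 < ((N : ℝ) - 1) / N := by
    have : (2 : ℝ) ≤ N := by exact_mod_cast hN
    exact div_pos (by linarith) (by linarith)
  set c : ℝ := ((N : ℝ) - 1) / N with hcdef
  have hK : 0 ≤ K := (hk.trans hkK).le
  have hK2 : ∀ y, |deriv (deriv h) y| ≤ K := fun y =>
    abs_le.2 ⟨by linarith [hlb y], hub y⟩
  have hd1 : ContDiff ℝ 1 (deriv h) := ((contDiff_succ_iff_deriv (n := 1)).1 hC2).2.2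
  have hg0 : Differentiable ℝ h := hC2.differentiable (by norm_num)
  have hg1 : Differentiable ℝ (deriv h) := hd1.differentiable (by norm_num)
  have hg2 : Continuous (deriv (deriv h)) := hd1.continuous_deriv le_rfl
  have hlin := abs_deriv_le_add_mul_abs hC2 hK2
  have hD : 0 ≤ |deriv h 0| := abs_nonneg _
  have hb1 : ∀ y, |deriv h y| ≤ (|deriv h 0| + K) + K * y ^ 2 := fun y => by
    have := hlin y
    nlinarith [sq_abs y, mul_nonneg hK (sq_nonneg (|y| - 1)), mul_nonneg hK (abs_nonneg y)]
  have hb0 : ∀ y, |h y| ≤ (|h 0| + |deriv h 0|) + (|deriv h 0| + K) * y ^ 2 := fun y => by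
    have h1 := abs_sub_le_of_abs_deriv_le hg0 hK hlin y
    have h2 := abs_add_le (h y - h 0) (h 0)
    rw [sub_add_cancel] at h2
    nlinarith [sq_abs y, mul_nonneg hD (sq_nonneg (|y| - 1)), mul_nonneg hD (abs_nonneg y)]
  have hb2 : ∀ y, |deriv (deriv h) y| ≤ K + 0 * y ^ 2 := by simpa using hK2
  have := isFiniteMeasure_discountMeasure hα
  set μ := (discountMeasure α).prod (gaussianReal 0 1) with hμ
  set X : ℝ × ℝ → ℝ := fun ω => √(c * ω.1) * ω.2 with hXdef
  have hX : AEStronglyMeasurable X μ := by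
    have : Continuous X := by fun_prop
    exact this.aestronglyMeasurable
  have hX2 : Integrable (fun ω => X ω ^ 2) μ := integrable_sq_sqrt_mul_prod hα hc.le
  have hi0 := integrable_comp_add_of_quadratic_growth hX hX2 hg0.continuous (by positivity) hb0
  have hi1 := integrable_comp_add_of_quadratic_growth hX hX2 hg1.continuous hK hb1
  have hi2 := integrable_comp_add_of_quadratic_growth hX hX2 hg2 le_rfl hb2
  have hp : pN N α h = fun x => ∫ ω, h (c * x + X ω) ∂μ :=
    funext fun x => pN_eq_integral_prod hα hg0.continuous hc.le x (hi0 (c * x))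
  have hlinc : ∀ x, HasDerivAt (fun x => c * x) c x := fun x => by
    simpa using (hasDerivAt_id x).const_mul c
  have hp1 : ∀ x, HasDerivAt (pN N α h) ((∫ ω, deriv h (c * x + X ω) ∂μ) * c) x := fun x => by
    rw [hp]
    exact (hasDerivAt_integral_comp_add hX hX2 hg0 hg1.continuous hK hb1 (c * x)
      (hi0 _)).comp x (hlinc x)
  have hp2 : ∀ x, HasDerivAt (deriv (pN N α h))
      ((∫ ω, deriv (deriv h) (c * x + X ω) ∂μ) * c * c) x := fun x => by
    rw [funext fun x => (hp1 x).deriv]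
    exact ((hasDerivAt_integral_comp_add hX hX2 hg1 hg2 le_rfl hb2 (c * x)
      (hi1 _)).comp x (hlinc x)).mul_const c
  have hμu : μ.real univ = 1 / α := by
    rw [hμ, ← univ_prod_univ, measureReal_prod_prod, measureReal_univ_discountMeasure hα]
    simp
  have hbounds : ∀ x : ℝ, c ^ 2 * (k / α) ≤ deriv (deriv (pN N α h)) x ∧
      deriv (deriv (pN N α h)) x ≤ c ^ 2 * (K / α) := fun x => by
    have hlow := integral_mono (integrable_const k) (hi2 (c * x)) fun ω => hlb _
    have hupp := integral_mono (hi2 (c * x)) (integrable_const K) fun ω => hub _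
    rw [integral_const, hμu, smul_eq_mul, one_div_mul_eq_div] at hlow hupp
    rw [(hp2 x).deriv, mul_assoc, ← sq, mul_comm _ (c ^ 2)]
    exact ⟨by gcongr, by gcongr⟩
  have hdiff : Differentiable ℝ (pN N α h) := fun x => (hp1 x).differentiableAt
  refine ⟨hdiff, fun x => (hp2 x).differentiableAt, hbounds, ?_⟩
  refine strictConvexOn_univ_of_deriv2_pos hdiff.continuous fun x => ?_
  exact lt_of_lt_of_le (by positivity) (hbounds x).1
end

section
/- Let c be the unique positive root of w·tanh(w) = 1, set β = √(2(N−1)α/N) and b := c/β, and define F : (0,b] → ℝ by F(x) = ∫_x^b (1 − tanh(β·z)/(β·z))^{−1} dz (the threshold function f_N^{sq} of equation (4.15) for h(x) = x², restricted to positive arguments). Then: (i) the integrand (1 − tanh(β·z)/(β·z))^{−1} is positive for 0 < z < b, so F(x) ≥ 0 with F(b) = 0; (ii) F is continuous and strictly decreasing on (0,b]; and (iii) F(x) → +∞ as x → 0+. -/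
open MeasureTheory Real Set Filter Topology

theorem Real.tanh_lt_self {w : ℝ} (hw : 0 < w) : tanh w < w := by
  obtain ⟨ξ, ⟨hξ0, hξw⟩, hξ⟩ := exists_deriv_eq_slope sinh hw
    continuous_sinh.continuousOn differentiable_sinh.differentiableOn
  have hcosh : cosh ξ < cosh w := by
    rw [cosh_lt_cosh, abs_of_pos hξ0, abs_of_pos hw]
    exact hξw
  rw [Real.deriv_sinh, sinh_zero, sub_zero, sub_zero, eq_div_iff hw.ne'] at hξ
  rw [tanh_eq_sinh_div_cosh, div_lt_iff₀ (cosh_pos w), ← hξ, mul_comm w]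
  gcongr

theorem Real.mul_one_sub_sq_le_tanh {w : ℝ} (hw : 0 < w) : w * (1 - w ^ 2) ≤ tanh w := by
  have hinv : 1 - w ^ 2 ≤ (cosh w)⁻¹ := calc
    1 - w ^ 2 ≤ -(w ^ 2 / 2) + 1 := by nlinarith [sq_nonneg w]
    _ ≤ exp (-(w ^ 2 / 2)) := add_one_le_exp _
    _ = (exp (w ^ 2 / 2))⁻¹ := exp_neg _
    _ ≤ (cosh w)⁻¹ := inv_anti₀ (cosh_pos w) (cosh_le_exp_half_sq w)
  rw [tanh_eq_sinh_div_cosh, div_eq_mul_inv]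
  calc w * (1 - w ^ 2) ≤ w * (cosh w)⁻¹ := by gcongr
    _ ≤ sinh w * (cosh w)⁻¹ :=
      mul_le_mul_of_nonneg_right (self_le_sinh_iff.2 hw.le) (inv_nonneg.2 (cosh_pos w).le)

theorem Real.one_sub_tanh_div_self_pos {w : ℝ} (hw : 0 < w) : 0 < 1 - tanh w / w := by
  rw [sub_pos, div_lt_one hw]
  exact tanh_lt_self hw

theorem Real.inv_sq_le_inv_one_sub_tanh_div_self {w : ℝ} (hw : 0 < w) :
    (w ^ 2)⁻¹ ≤ (1 - tanh w / w)⁻¹ := by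
  refine inv_anti₀ (one_sub_tanh_div_self_pos hw) ?_
  rw [sub_le_comm, le_div_iff₀ hw, mul_comm]
  exact mul_one_sub_sq_le_tanh hw

theorem Real.continuousOn_inv_one_sub_tanh_div_self {β : ℝ} (hβ : 0 < β) :
    ContinuousOn (fun z => (1 - tanh (β * z) / (β * z))⁻¹) (Ioi 0) := by
  have htanh : Continuous tanh := by
    simp_rw [funext tanh_eq_sinh_div_cosh]
    exact continuous_sinh.div continuous_cosh fun x => (cosh_pos x).ne'
  have hlin : Continuous fun z => β * z := continuous_const_mul β
  refine (continuousOn_const.sub ((htanh.comp hlin).continuousOn.div hlin.continuousOn ?_)).inv₀ ?_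
  · intro z hz
    exact (mul_pos hβ hz).ne'
  · intro z hz
    exact (one_sub_tanh_div_self_pos (mul_pos hβ hz)).ne'

section IntegralOfPositive

variable {f : ℝ → ℝ} {b : ℝ}

theorem intervalIntegrable_of_continuousOn_Ioi (hf : ContinuousOn f (Ioi 0)) {x y : ℝ}
    (hx : 0 < x) (hy : 0 < y) : IntervalIntegrable f volume x y :=
  (hf.mono fun _ hz => (lt_min hx hy).trans_le hz.1).intervalIntegrable

theorem continuousOn_integral_left (hf : ContinuousOn f (Ioi 0)) (hb : 0 < b) :
    ContinuousOn (fun x => ∫ z in x..b, f z) (Ioi 0) := fun x hx =>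
  (intervalIntegral.integral_hasDerivAt_left (intervalIntegrable_of_continuousOn_Ioi hf hx hb)
    (hf.stronglyMeasurableAtFilter isOpen_Ioi x hx)
    (hf.continuousAt (Ioi_mem_nhds hx))).continuousAt.continuousWithinAt

theorem strictAntiOn_integral_left (hf : ContinuousOn f (Ioi 0)) (hpos : ∀ z, 0 < z → 0 < f z)
    (hb : 0 < b) : StrictAntiOn (fun x => ∫ z in x..b, f z) (Ioi 0) := by
  intro x hx y hy hxy
  have hint := intervalIntegrable_of_continuousOn_Ioi hf hx hy
  have hgap : 0 < ∫ z in x..y, f z :=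
    intervalIntegral.intervalIntegral_pos_of_pos_on hint
      (fun z hz => hpos z (lt_trans hx hz.1)) hxy
  have hsplit := intervalIntegral.integral_add_adjacent_intervals hint
    (intervalIntegrable_of_continuousOn_Ioi hf hy hb)
  change (∫ z in y..b, f z) < ∫ z in x..b, f z
  linarith

theorem tendsto_integral_left_atTop (hf : ContinuousOn f (Ioi 0)) {k : ℝ} (hk : 0 < k)
    (hle : ∀ z, 0 < z → k * (z ^ 2)⁻¹ ≤ f z) (hb : 0 < b) :
    Tendsto (fun x => ∫ z in x..b, f z) (𝓝[>] 0) atTop := by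
  have hlower : Tendsto (fun x : ℝ => k * (x⁻¹ - b⁻¹)) (𝓝[>] 0) atTop :=
    (tendsto_atTop_add_const_right _ (-b⁻¹) tendsto_inv_nhdsGT_zero).const_mul_atTop hk
  refine tendsto_atTop_mono' _ ?_ hlower
  filter_upwards [Ioo_mem_nhdsGT hb] with x ⟨hx, hxb⟩
  have hcont : ContinuousOn (fun z : ℝ => k * (z ^ 2)⁻¹) (Ioi 0) :=
    continuousOn_const.mul ((continuousOn_pow 2).inv₀ fun z hz => (pow_pos hz 2).ne')
  have hint := intervalIntegrable_of_continuousOn_Ioi hcont hx hb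
  have hvalue : ∫ z in x..b, k * (z ^ 2)⁻¹ = k * (x⁻¹ - b⁻¹) := by
    rw [intervalIntegral.integral_eq_sub_of_hasDerivAt (f := fun z => -(k * z⁻¹)) ?_ hint]
    · ring
    · intro z hz
      have hz0 : z ≠ 0 := ((lt_min hx hb).trans_le hz.1).ne'
      simpa using ((hasDerivAt_inv hz0).const_mul k).fun_neg
  rw [← hvalue]
  exact intervalIntegral.integral_mono_on hxb.le hint
    (intervalIntegrable_of_continuousOn_Ioi hf hx hb) fun z hz => hle z (hx.trans_le hz.1)

end IntegralOfPositive

/-- Properties of the explicit free-boundary threshold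
`F(x) = ∫_x^b (1 − tanh(βz)/(βz))⁻¹ dz` for the quadratic cost:
the integrand is positive on `(0,b)`, `F ≥ 0` with `F(b) = 0`, `F` is continuous and
strictly decreasing on `(0,b]`, and `F(x) → +∞` as `x → 0+`. -/
theorem threshold_function_properties (N : ℕ) (hN : 2 ≤ N) (α : ℝ) (hα : 0 < α)
    (β : ℝ) (hβ : β = Real.sqrt (2 * ((N:ℝ) - 1) * α / N))
    (c : ℝ) (hc : 0 < c) (hc1 : c * Real.tanh c = 1)
    (b : ℝ) (hb : b = c / β)
    (F : ℝ → ℝ)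
    (hF : F = fun x => ∫ z in x..b, (1 - Real.tanh (β * z) / (β * z))⁻¹) :
    (∀ z : ℝ, 0 < z → z < b → 0 < (1 - Real.tanh (β * z) / (β * z))⁻¹) ∧
    (∀ x ∈ Ioc (0:ℝ) b, 0 ≤ F x) ∧
    F b = 0 ∧
    ContinuousOn F (Ioc (0:ℝ) b) ∧
    StrictAntiOn F (Ioc (0:ℝ) b) ∧
    Tendsto F (𝓝[>] 0) atTop := by
  have hN' : (2 : ℝ) ≤ N := by exact_mod_cast hN
  have hβ0 : 0 < β := by
    rw [hβ]
    have : 0 < (N : ℝ) - 1 := by linarith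
    positivity
  have hb0 : 0 < b := hb ▸ div_pos hc hβ0
  have hcont := continuousOn_inv_one_sub_tanh_div_self hβ0
  have hpos : ∀ z : ℝ, 0 < z → 0 < (1 - Real.tanh (β * z) / (β * z))⁻¹ := fun z hz =>
    inv_pos.2 (one_sub_tanh_div_self_pos (mul_pos hβ0 hz))
  subst hF
  refine ⟨fun z hz _ => hpos z hz, fun x hx => ?_, intervalIntegral.integral_same,
    (continuousOn_integral_left hcont hb0).mono Ioc_subset_Ioi_self,
    (strictAntiOn_integral_left hcont hpos hb0).mono Ioc_subset_Ioi_self,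
    tendsto_integral_left_atTop hcont (k := (β ^ 2)⁻¹) (by positivity) (fun z hz => ?_) hb0⟩
  · exact intervalIntegral.integral_nonneg hx.2 fun z hz => (hpos z (hx.1.trans_le hz.1)).le
  · rw [← mul_inv, ← mul_pow]
    exact inv_sq_le_inv_one_sub_tanh_div_self (mul_pos hβ0 hz)
end

section
/- Let c be the unique positive root of w·tanh(w) = 1, set β = √(2(N−1)α/N) and b := c/β, and define Ǎ : [0,∞) → ℝ by Ǎ(x) := −(N/(N−1))·α²·(cosh(β·x) − β·x·sinh(β·x)) (the composition A_N^{sq}(f_N^{sq}(x)) from equation (4.16) for the quadratic cost h(x) = x²). Then Ǎ is strictly increasing on [0,∞), Ǎ(x) < 0 for 0 ≤ x < b, and Ǎ(b) = 0. -/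
open MeasureTheory Real Set Filter Topology

/-- The function `w ↦ w sinh w - cosh w` is strictly increasing on `[0,∞)`. -/
theorem strictMonoOn_mul_sinh_sub_cosh :
    StrictMonoOn (fun w : ℝ => w * Real.sinh w - Real.cosh w) (Set.Ici 0) := by
  apply strictMonoOn_of_deriv_pos (convex_Ici 0)
  · fun_prop
  · intro w hw
    rw [interior_Ici, Set.mem_Ioi] at hw
    have h := ((hasDerivAt_id' w).mul (Real.hasDerivAt_sinh w)).sub (Real.hasDerivAt_cosh w)
    have hd : deriv (fun w : ℝ => w * Real.sinh w - Real.cosh w) w = w * Real.cosh w := by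
      refine (h.congr_deriv ?_).deriv
      ring
    rw [hd]
    exact mul_pos hw (Real.cosh_pos w)

/-- For the quadratic cost, `Ǎ(x) = −(N/(N−1)) α² (cosh(βx) − βx sinh(βx))`
(the composition `A_N^{sq}(f_N^{sq}(x))`) is strictly increasing on `[0,∞)`,
negative on `[0,b)` and vanishes at `b = c/β`. -/
theorem A_sq_along_boundary (N : ℕ) (hN : 2 ≤ N) (α : ℝ) (hα : 0 < α)
    (β : ℝ) (hβ : β = Real.sqrt (2 * ((N:ℝ) - 1) * α / N))
    (c : ℝ) (hc : 0 < c) (hc1 : c * Real.tanh c = 1)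
    (b : ℝ) (hb : b = c / β)
    (Acheck : ℝ → ℝ)
    (hA : Acheck = fun x => -((N:ℝ) / ((N:ℝ) - 1)) * α^2 *
      (Real.cosh (β * x) - β * x * Real.sinh (β * x))) :
    StrictMonoOn Acheck (Set.Ici 0) ∧
    (∀ x : ℝ, 0 ≤ x → x < b → Acheck x < 0) ∧
    Acheck b = 0 := by
  have hN1 : (0 : ℝ) < (N : ℝ) - 1 := by
    have : (2 : ℝ) ≤ N := by exact_mod_cast hN
    linarith
  have hN0 : (0 : ℝ) < N := by linarith
  have hβ0 : 0 < β := by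
    rw [hβ]
    exact Real.sqrt_pos.mpr (by positivity)
  have hβb : β * b = c := by
    rw [hb]
    field_simp
  have hb0 : 0 ≤ b := by
    rw [hb]
    positivity
  have hK : 0 < (N : ℝ) / ((N : ℝ) - 1) * α ^ 2 := by positivity
  have hmono : StrictMonoOn Acheck (Set.Ici 0) := by
    intro x hx y hy hxy
    have h := strictMonoOn_mul_sinh_sub_cosh
      (Set.mem_Ici.mpr (mul_nonneg hβ0.le hx)) (Set.mem_Ici.mpr (mul_nonneg hβ0.le hy))
      (mul_lt_mul_of_pos_left hxy hβ0)
    have h' := mul_lt_mul_of_pos_left h hK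
    simp only [hA]
    linarith
  have hzero : Acheck b = 0 := by
    have hcosh : c * Real.sinh c = Real.cosh c := by
      have := (Real.cosh_pos c).ne'
      rw [Real.tanh_eq_sinh_div_cosh] at hc1
      field_simp at hc1
      exact hc1
    simp only [hA, hβb, hcosh, sub_self, mul_zero]
  exact ⟨hmono, fun x hx hxb => hzero ▸ hmono hx hb0 hxb, hzero⟩
end
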